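/- arXiv:2107.04541 — 4 statements merged into one kernel-verified Lean document; each statement's English description precedes it below -/
import Mathlib

section
/- For all reals α > 0 and 0 < ∇ < σ, the function f(x) = σ·(√(4α² + x²) + x)/2 − ∇·x on ℝ attains its global minimum at the unique point x* = α·(2∇ − σ)/√(∇·(σ − ∇)); consequently the solution error of the algebraic less-than penalty is |ε| = α·|σ − 2∇|·√(1/(∇·(σ − ∇))). -/
/-- The value of the penalized objective at its critical point, where `r` is the
geometric mean of `g` and `s - g`. -/
theorem penalized_objective_at_minimizer {α g s r : ℝ} (hα : 0 ≤ α) (hs : 0 ≤ s)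
    (hr : 0 < r) (hr2 : r ^ 2 = g * (s - g)) :
    s * (Real.sqrt (4 * α ^ 2 + (α * (2 * g - s) / r) ^ 2) + α * (2 * g - s) / r) / 2 -
      g * (α * (2 * g - s) / r) = 2 * α * r := by
  have hsq : 4 * α ^ 2 + (α * (2 * g - s) / r) ^ 2 = (α * s / r) ^ 2 := by
    field_simp
    linear_combination 4 * α ^ 2 * hr2
  rw [hsq, Real.sqrt_sq (by positivity)]
  field_simp
  linear_combination -4 * α * hr2

/-- Away from its critical point, the penalized objective exceeds its critical value. -/
theorem lt_penalized_objective {α g s r x : ℝ} (hs : 0 ≤ s) (hr : 0 < r)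
    (hr2 : r ^ 2 = g * (s - g)) (hx : x ≠ α * (2 * g - s) / r) :
    2 * α * r < s * (Real.sqrt (4 * α ^ 2 + x ^ 2) + x) / 2 - g * x := by
  have hne : α * (2 * g - s) - x * r ≠ 0 := fun h =>
    hx ((eq_div_iff hr.ne').2 (sub_eq_zero.1 h).symm)
  have hpos : 0 < (α * (2 * g - s) - x * r) ^ 2 := by positivity
  have hq : Real.sqrt (4 * α ^ 2 + x ^ 2) ^ 2 = 4 * α ^ 2 + x ^ 2 :=
    Real.sq_sqrt (by positivity)
  have hdiff : (s * Real.sqrt (4 * α ^ 2 + x ^ 2)) ^ 2 - ((2 * g - s) * x + 4 * α * r) ^ 2 =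
      4 * (α * (2 * g - s) - x * r) ^ 2 := by
    linear_combination s ^ 2 * hq - (16 * α ^ 2 + 4 * x ^ 2) * hr2
  have hlt : (2 * g - s) * x + 4 * α * r < s * Real.sqrt (4 * α ^ 2 + x ^ 2) :=
    lt_of_pow_lt_pow_left₀ 2 (by positivity) (by linarith)
  linarith

/-- For `α > 0` and `0 < ∇ < σ`, the function
`f(x) = σ·(√(4α² + x²) + x)/2 − ∇·x` attains its global minimum at the unique
point `x* = α·(2∇ − σ)/√(∇·(σ − ∇))`; hence the algebraic less-than penalty
solution error is `|ε| = α·|σ − 2∇|·√(1/(∇·(σ − ∇)))`. -/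
theorem algebraic_lt_error (α grad sigma : ℝ) (hα : 0 < α) (hg : 0 < grad)
    (hgs : grad < sigma) :
    (∀ x : ℝ,
        sigma * (Real.sqrt (4 * α ^ 2 + (α * (2 * grad - sigma) /
            Real.sqrt (grad * (sigma - grad))) ^ 2) +
          α * (2 * grad - sigma) / Real.sqrt (grad * (sigma - grad))) / 2 -
          grad * (α * (2 * grad - sigma) / Real.sqrt (grad * (sigma - grad)))
        ≤ sigma * (Real.sqrt (4 * α ^ 2 + x ^ 2) + x) / 2 - grad * x) ∧
    (∀ x : ℝ, x ≠ α * (2 * grad - sigma) / Real.sqrt (grad * (sigma - grad)) →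
        sigma * (Real.sqrt (4 * α ^ 2 + (α * (2 * grad - sigma) /
            Real.sqrt (grad * (sigma - grad))) ^ 2) +
          α * (2 * grad - sigma) / Real.sqrt (grad * (sigma - grad))) / 2 -
          grad * (α * (2 * grad - sigma) / Real.sqrt (grad * (sigma - grad)))
        < sigma * (Real.sqrt (4 * α ^ 2 + x ^ 2) + x) / 2 - grad * x) ∧
    |α * (2 * grad - sigma) / Real.sqrt (grad * (sigma - grad))|
      = α * |sigma - 2 * grad| * Real.sqrt (1 / (grad * (sigma - grad))) := by
  set r := Real.sqrt (grad * (sigma - grad)) with hr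
  have hp : 0 < grad * (sigma - grad) := mul_pos hg (sub_pos.2 hgs)
  have hr0 : 0 < r := Real.sqrt_pos.2 hp
  have hr2 : r ^ 2 = grad * (sigma - grad) := Real.sq_sqrt hp.le
  have hs : 0 < sigma := hg.trans hgs
  have hval := penalized_objective_at_minimizer hα.le hs.le hr0 hr2
  have hlt : ∀ x : ℝ, x ≠ α * (2 * grad - sigma) / r →
      2 * α * r < sigma * (Real.sqrt (4 * α ^ 2 + x ^ 2) + x) / 2 - grad * x :=
    fun x hx => lt_penalized_objective hs.le hr0 hr2 hx
  rw [hval]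
  refine ⟨fun x => ?_, hlt, ?_⟩
  · rcases eq_or_ne x (α * (2 * grad - sigma) / r) with rfl | hx
    · exact hval.ge
    · exact (hlt x hx).le
  · rw [abs_div, abs_mul, abs_of_pos hα, abs_of_pos hr0, abs_sub_comm, one_div,
      Real.sqrt_inv, ← hr, div_eq_mul_inv]
end

section
/- For all reals α > 0 and 0 < ∇ < σ, the function f(x) = σ·α·log₂(1 + 2^(x/α)) − ∇·x on ℝ attains its global minimum at the unique point x* = α·log₂(∇/(σ − ∇)); consequently the solution error of the softplus less-than penalty is |ε| = α·|log₂(∇/(σ − ∇))|. -/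
/-- Strict Gibbs inequality for two outcomes with weights `p` and `r`, in odds form. -/
theorem mul_log_one_add_sub_mul_log_lt {p r u : ℝ} (hp : 0 < p) (hr : 0 < r) (hu : 0 < u)
    (hne : u ≠ p / r) :
    (p + r) * Real.log (1 + p / r) - p * Real.log (p / r)
      < (p + r) * Real.log (1 + u) - p * Real.log u := by
  have hs : 0 < p + r := by positivity
  have hu1 : 0 < 1 + u := by positivity
  have hne1 : (p + r) / (r * (1 + u)) ≠ 1 := by
    intro h
    rw [div_eq_one_iff_eq (by positivity)] at h
    exact hne ((eq_div_iff hr.ne').2 (by linarith))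
  have h₁ := mul_lt_mul_of_pos_left (Real.log_lt_sub_one_of_pos (by positivity) hne1) hr
  have h₂ := mul_le_mul_of_nonneg_left
    (Real.log_le_sub_one_of_pos (show 0 < u * (p + r) / (p * (1 + u)) by positivity)) hp.le
  have hsum : r * ((p + r) / (r * (1 + u)) - 1) + p * (u * (p + r) / (p * (1 + u)) - 1) = 0 := by
    field_simp
    ring
  rw [Real.log_div hs.ne' (by positivity), Real.log_mul hr.ne' hu1.ne'] at h₁
  rw [Real.log_div (by positivity) (by positivity), Real.log_mul hu.ne' hs.ne',
    Real.log_mul hp.ne' hu1.ne'] at h₂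
  have hodds : 1 + p / r = (p + r) / r := by
    field_simp
    ring
  rw [hodds, Real.log_div hs.ne' hr.ne', Real.log_div hp.ne' hr.ne']
  linarith


/-- For `α > 0` and `0 < ∇ < σ`, the function
`f(x) = σ·α·log₂(1 + 2^(x/α)) − ∇·x` attains its global minimum at the unique
point `x* = α·log₂(∇/(σ − ∇))`; hence the softplus less-than penalty solution
error is `|ε| = α·|log₂(∇/(σ − ∇))|`. -/
theorem softplus_lt_error (α grad sigma : ℝ) (hα : 0 < α) (hg : 0 < grad)
    (hgs : grad < sigma) :
    (∀ x : ℝ,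
        sigma * (α * Real.logb 2 (1 + (2 : ℝ) ^
            (α * Real.logb 2 (grad / (sigma - grad)) / α))) -
          grad * (α * Real.logb 2 (grad / (sigma - grad)))
        ≤ sigma * (α * Real.logb 2 (1 + (2 : ℝ) ^ (x / α))) - grad * x) ∧
    (∀ x : ℝ, x ≠ α * Real.logb 2 (grad / (sigma - grad)) →
        sigma * (α * Real.logb 2 (1 + (2 : ℝ) ^
            (α * Real.logb 2 (grad / (sigma - grad)) / α))) -
          grad * (α * Real.logb 2 (grad / (sigma - grad)))
        < sigma * (α * Real.logb 2 (1 + (2 : ℝ) ^ (x / α))) - grad * x) ∧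
    |α * Real.logb 2 (grad / (sigma - grad))|
      = α * |Real.logb 2 (grad / (sigma - grad))| := by
  have hr : 0 < sigma - grad := sub_pos.2 hgs
  have hu₀ : 0 < grad / (sigma - grad) := div_pos hg hr
  have hlt : ∀ x : ℝ, x ≠ α * Real.logb 2 (grad / (sigma - grad)) →
      sigma * (α * Real.logb 2 (1 + (2 : ℝ) ^
          (α * Real.logb 2 (grad / (sigma - grad)) / α))) -
        grad * (α * Real.logb 2 (grad / (sigma - grad)))
      < sigma * (α * Real.logb 2 (1 + (2 : ℝ) ^ (x / α))) - grad * x := by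
    intro x hx
    have hxu : x = α * Real.logb 2 ((2 : ℝ) ^ (x / α)) := by
      rw [Real.logb_rpow (by norm_num) (by norm_num)]
      field_simp
    have hu : 0 < (2 : ℝ) ^ (x / α) := by positivity
    rw [mul_div_cancel_left₀ _ hα.ne', Real.rpow_logb (by norm_num) (by norm_num) hu₀]
    generalize (2 : ℝ) ^ (x / α) = u at hxu hu ⊢
    subst hxu
    have key := mul_log_one_add_sub_mul_log_lt hg hr hu fun h => hx (by rw [h])
    rw [add_sub_cancel] at key
    have hc : 0 < α / Real.log 2 := div_pos hα (Real.log_pos (by norm_num))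
    have hscaled := mul_lt_mul_of_pos_left key hc
    simp only [Real.logb]
    generalize Real.log (1 + grad / (sigma - grad)) = a, Real.log (grad / (sigma - grad)) = b,
      Real.log (1 + u) = c, Real.log u = d at hscaled ⊢
    calc
      _ = α / Real.log 2 * (sigma * a - grad * b) := by ring
      _ < α / Real.log 2 * (sigma * c - grad * d) := hscaled
      _ = _ := by ring
  refine ⟨fun x => ?_, hlt, by rw [abs_mul, abs_of_pos hα]⟩
  rcases eq_or_ne x (α * Real.logb 2 (grad / (sigma - grad))) with rfl | hx
  · exact le_rfl
  · exact (hlt x hx).le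
end

section
/- For all reals α > 0 and ∇, σ with 0 < |∇| < σ, the function f(x) = σ·(2α·log₂(1 + 2^(x/α)) − x) − ∇·x on ℝ attains its global minimum at the unique point x* = α·log₂((σ + ∇)/(σ − ∇)); consequently the solution error of the softplus equality penalty is |ε| = α·|log₂((∇ + σ)/(σ − ∇))|. -/
/-- Strict minimality of `u = a / b` for the function `(a + b) log (1 + u) - a log u` on
the positive reals. -/
theorem add_mul_log_one_add_sub_mul_log_lt {a b u : ℝ} (ha : 0 < a) (hb : 0 < b) (hu : 0 < u)
    (hne : u ≠ a / b) :
    (a + b) * Real.log (1 + a / b) - a * Real.log (a / b)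
      < (a + b) * Real.log (1 + u) - a * Real.log u := by
  have hv : 0 < a / b := div_pos ha hb
  have hr : Real.log ((1 + a / b) / (1 + u)) = Real.log (1 + a / b) - Real.log (1 + u) :=
    Real.log_div (by positivity) (by positivity)
  have hs : Real.log (u / (a / b) * ((1 + a / b) / (1 + u)))
      = Real.log u - Real.log (a / b) + (Real.log (1 + a / b) - Real.log (1 + u)) := by
    rw [Real.log_mul (by positivity) (by positivity), hr, Real.log_div hu.ne' hv.ne']
  have hr1 : (1 + a / b) / (1 + u) ≠ 1 := by
    intro h
    rw [div_eq_one_iff_eq (by positivity)] at h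
    exact hne (by linarith)
  have hlr := Real.log_lt_sub_one_of_pos (by positivity) hr1
  have hls := Real.log_le_sub_one_of_pos
    (show 0 < u / (a / b) * ((1 + a / b) / (1 + u)) by positivity)
  have hsum : a * (u / (a / b) * ((1 + a / b) / (1 + u))) + b * ((1 + a / b) / (1 + u))
      = a + b := by
    field_simp
    ring
  rw [hr] at hlr
  rw [hs] at hls
  nlinarith [mul_lt_mul_of_pos_left hlr hb, mul_le_mul_of_nonneg_left hls ha.le]

/-- With `u = 2 ^ (x / α)`, the penalized objective is a positive multiple of
`2σ log (1 + u) - (σ + ∇) log u`. -/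
theorem softplus_objective_eq {α : ℝ} (grad sigma x : ℝ) (hα : 0 < α) :
    sigma * (2 * α * Real.logb 2 (1 + (2 : ℝ) ^ (x / α)) - x) - grad * x
      = α / Real.log 2 * (((sigma + grad) + (sigma - grad)) * Real.log (1 + (2 : ℝ) ^ (x / α))
        - (sigma + grad) * Real.log ((2 : ℝ) ^ (x / α))) := by
  have h2 : Real.log 2 ≠ 0 := (Real.log_pos one_lt_two).ne'
  rw [Real.log_rpow two_pos, Real.logb]
  field_simp
  ring

/-- For `α > 0` and `0 < |∇| < σ`, the function
`f(x) = σ·(2α·log₂(1 + 2^(x/α)) − x) − ∇·x` attains its global minimum at the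
unique point `x* = α·log₂((σ + ∇)/(σ − ∇))`; hence the softplus equality
penalty solution error is `|ε| = α·|log₂((∇ + σ)/(σ − ∇))|`. -/
theorem softplus_eq_error (α grad sigma : ℝ) (hα : 0 < α) (hg : 0 < |grad|)
    (hgs : |grad| < sigma) :
    (∀ x : ℝ,
        sigma * (2 * α * Real.logb 2 (1 + (2 : ℝ) ^
            (α * Real.logb 2 ((sigma + grad) / (sigma - grad)) / α)) -
          α * Real.logb 2 ((sigma + grad) / (sigma - grad))) -
          grad * (α * Real.logb 2 ((sigma + grad) / (sigma - grad)))
        ≤ sigma * (2 * α * Real.logb 2 (1 + (2 : ℝ) ^ (x / α)) - x) - grad * x) ∧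
    (∀ x : ℝ, x ≠ α * Real.logb 2 ((sigma + grad) / (sigma - grad)) →
        sigma * (2 * α * Real.logb 2 (1 + (2 : ℝ) ^
            (α * Real.logb 2 ((sigma + grad) / (sigma - grad)) / α)) -
          α * Real.logb 2 ((sigma + grad) / (sigma - grad))) -
          grad * (α * Real.logb 2 ((sigma + grad) / (sigma - grad)))
        < sigma * (2 * α * Real.logb 2 (1 + (2 : ℝ) ^ (x / α)) - x) - grad * x) ∧
    |α * Real.logb 2 ((grad + sigma) / (sigma - grad))|
      = α * |Real.logb 2 ((grad + sigma) / (sigma - grad))| := by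
  obtain ⟨hl, hr⟩ := abs_lt.mp hgs
  have ha : 0 < sigma + grad := by linarith
  have hb : 0 < sigma - grad := by linarith
  have hpow : (2 : ℝ) ^ (α * Real.logb 2 ((sigma + grad) / (sigma - grad)) / α)
      = (sigma + grad) / (sigma - grad) := by
    rw [mul_div_cancel_left₀ _ hα.ne',
      Real.rpow_logb two_pos (by norm_num) (div_pos ha hb)]
  have hlt : ∀ x : ℝ, x ≠ α * Real.logb 2 ((sigma + grad) / (sigma - grad)) →
      sigma * (2 * α * Real.logb 2 (1 + (2 : ℝ) ^
          (α * Real.logb 2 ((sigma + grad) / (sigma - grad)) / α)) -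
        α * Real.logb 2 ((sigma + grad) / (sigma - grad))) -
        grad * (α * Real.logb 2 ((sigma + grad) / (sigma - grad)))
      < sigma * (2 * α * Real.logb 2 (1 + (2 : ℝ) ^ (x / α)) - x) - grad * x := by
    intro x hx
    rw [softplus_objective_eq grad sigma _ hα, softplus_objective_eq grad sigma x hα, hpow]
    refine mul_lt_mul_of_pos_left ?_ (div_pos hα (Real.log_pos one_lt_two))
    refine add_mul_log_one_add_sub_mul_log_lt ha hb (by positivity) fun h => hx ?_
    rw [← h, Real.logb_rpow two_pos (by norm_num), mul_div_cancel₀ _ hα.ne']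
  refine ⟨fun x => ?_, hlt, by rw [abs_mul, abs_of_pos hα]⟩
  by_cases hx : x = α * Real.logb 2 ((sigma + grad) / (sigma - grad))
  · rw [← hx]
  · exact (hlt x hx).le
end

section
/- For all reals α > 0 and 0 < ∇ < σ, the global minimizer of f(x) = σ·α·log₂(1 + 2^(x/α)) − ∇·x equals 0 if and only if σ = 2∇, and likewise the global minimizer of h(x) = σ·(√(4α² + x²) + x)/2 − ∇·x equals 0 if and only if σ = 2∇; that is, both the softplus and algebraic less-than penalties produce zero solution error exactly when the scale parameter σ is twice the local objective gradient ∇. -/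
theorem forall_penalized_zero_le_iff {p : ℝ → ℝ} {a b : ℝ} (hb : 0 ≤ b)
    (hp : HasDerivAt p (1 / 2) 0) (hle : ∀ x, p 0 + x / 2 ≤ p x) :
    (∀ x, b * p 0 - a * 0 ≤ b * p x - a * x) ↔ b = 2 * a := by
  constructor
  · intro h
    have hd : HasDerivAt (fun x => b * p x - a * x) (b * (1 / 2) - a * 1) 0 :=
      (hp.const_mul b).sub ((hasDerivAt_id (0 : ℝ)).const_mul a)
    have hmin : IsLocalMin (fun x => b * p x - a * x) 0 := Filter.Eventually.of_forall h
    linarith [hmin.hasDerivAt_eq_zero hd]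
  · rintro rfl x
    nlinarith [mul_le_mul_of_nonneg_left (hle x) hb]

theorem hasDerivAt_softplus_zero {α : ℝ} (hα : α ≠ 0) :
    HasDerivAt (fun x : ℝ => α * Real.logb 2 (1 + (2 : ℝ) ^ (x / α))) (1 / 2) 0 := by
  have h2 : Real.log 2 ≠ 0 := (Real.log_pos one_lt_two).ne'
  have h := (((((hasDerivAt_id (0 : ℝ)).div_const α).const_rpow two_pos).const_add 1).log
    (by positivity)).div_const (Real.log 2) |>.const_mul α
  refine h.congr_deriv ?_
  simp only [id, zero_div, Real.rpow_zero]
  field_simp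
  norm_num

theorem softplus_zero_add_half_le {α : ℝ} (hα : 0 < α) (x : ℝ) :
    α * Real.logb 2 (1 + (2 : ℝ) ^ ((0 : ℝ) / α)) + x / 2
      ≤ α * Real.logb 2 (1 + (2 : ℝ) ^ (x / α)) := by
  have key : 1 + x / α / 2 ≤ Real.logb 2 (1 + (2 : ℝ) ^ (x / α)) := by
    rw [Real.le_logb_iff_rpow_le one_lt_two (by positivity), Real.rpow_add two_pos,
      Real.rpow_one]
    have hsq : (2 : ℝ) ^ (x / α) = (2 : ℝ) ^ (x / α / 2) * (2 : ℝ) ^ (x / α / 2) := by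
      rw [← Real.rpow_add two_pos, add_halves]
    rw [hsq]
    nlinarith [sq_nonneg ((2 : ℝ) ^ (x / α / 2) - 1)]
  have h0 : Real.logb 2 (1 + (2 : ℝ) ^ ((0 : ℝ) / α)) = 1 := by
    rw [zero_div, Real.rpow_zero, one_add_one_eq_two, Real.logb_self_eq_one one_lt_two]
  calc _ = α * (1 + x / α / 2) := by rw [h0]; field_simp
    _ ≤ _ := mul_le_mul_of_nonneg_left key hα.le

theorem hasDerivAt_algebraic_zero {α : ℝ} (hα : α ≠ 0) :
    HasDerivAt (fun x : ℝ => (Real.sqrt (4 * α ^ 2 + x ^ 2) + x) / 2) (1 / 2) 0 := by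
  have h := ((((hasDerivAt_pow 2 (0 : ℝ)).const_add (4 * α ^ 2)).sqrt
    (by positivity)).add (hasDerivAt_id (0 : ℝ))).div_const 2
  exact h.congr_deriv (by simp)

theorem algebraic_zero_add_half_le (α x : ℝ) :
    (Real.sqrt (4 * α ^ 2 + (0 : ℝ) ^ 2) + 0) / 2 + x / 2
      ≤ (Real.sqrt (4 * α ^ 2 + x ^ 2) + x) / 2 := by
  have h : Real.sqrt (4 * α ^ 2 + (0 : ℝ) ^ 2) ≤ Real.sqrt (4 * α ^ 2 + x ^ 2) :=
    Real.sqrt_le_sqrt (by nlinarith [sq_nonneg x])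
  rw [add_zero, ← add_div]
  gcongr

/-- For `α > 0` and `0 < ∇ < σ`, the global minimizer of
`f(x) = σ·α·log₂(1 + 2^(x/α)) − ∇·x` is `0` iff `σ = 2∇`, and likewise the
global minimizer of `h(x) = σ·(√(4α² + x²) + x)/2 − ∇·x` is `0` iff `σ = 2∇`:
both less-than penalties yield zero solution error exactly when `σ` is twice
the local objective gradient `∇`. -/
theorem lt_penalties_zero_error_iff (α grad sigma : ℝ) (hα : 0 < α)
    (hg : 0 < grad) (hgs : grad < sigma) :
    ((∀ x : ℝ,
        sigma * (α * Real.logb 2 (1 + (2 : ℝ) ^ ((0 : ℝ) / α))) - grad * 0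
          ≤ sigma * (α * Real.logb 2 (1 + (2 : ℝ) ^ (x / α))) - grad * x) ↔
      sigma = 2 * grad) ∧
    ((∀ x : ℝ,
        sigma * (Real.sqrt (4 * α ^ 2 + (0 : ℝ) ^ 2) + 0) / 2 - grad * 0
          ≤ sigma * (Real.sqrt (4 * α ^ 2 + x ^ 2) + x) / 2 - grad * x) ↔
      sigma = 2 * grad) := by
  have hs : 0 ≤ sigma := (hg.trans hgs).le
  refine ⟨forall_penalized_zero_le_iff hs (hasDerivAt_softplus_zero hα.ne')
    (softplus_zero_add_half_le hα), ?_⟩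
  simp only [mul_div_assoc]
  exact forall_penalized_zero_le_iff hs (hasDerivAt_algebraic_zero hα.ne')
    (algebraic_zero_add_half_le α)
end
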